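/- Let d ≥ 1, let V ⊆ ℝ^d be an open convex cone with vertex at 0 not containing 0, and let a > 0. Let (g_n) be a sequence of functions holomorphic on W = {x + iy ∈ ℂ^d : y ∈ V, ‖y‖ < a}, all satisfying |g_n(x+iy)| ≤ C (1 + ‖x‖^2)^L ‖y‖^{-2K} on W with the same constants C > 0 and nonnegative integers L, K for all n, and suppose g_n converges pointwise on W to g. Then g is holomorphic on W and satisfies the same bound, and for every v ∈ V and every Schwartz function f : ℝ^d → ℂ, lim_{n→∞} [lim_{ε→0+} ∫_{ℝ^d} g_n(x + iεv) f(x) dx] = lim_{ε→0+} ∫_{ℝ^d} g(x + iεv) f(x) dx, where all inner limits exist and are finite. -/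

import Mathlib

open MeasureTheory Filter Complex

open Metric Set in
/-- A pointwise limit of uniformly bounded holomorphic functions on a ball of a finite-dimensional
complex space is complex differentiable at the centre. -/
theorem differentiableAt_of_tendsto_of_norm_le {E : Type*} [NormedAddCommGroup E]
    [NormedSpace ℂ E] [FiniteDimensional ℂ E] {f : ℕ → E → ℂ} {g : E → ℂ} {c : E} {r M : ℝ}
    (hr : 0 < r) (hd : ∀ n, DifferentiableOn ℂ (f n) (ball c r))
    (hM : ∀ n, ∀ z ∈ ball c r, ‖f n z‖ ≤ M)
    (hlim : ∀ z ∈ ball c r, Tendsto (fun n => f n z) atTop (nhds (g z))) :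
    DifferentiableAt ℂ g c := by
  have hc : c ∈ ball c r := mem_ball_self hr
  have hfd : ∀ n, HasFDerivAt (f n) (fderiv ℂ (f n) c) c := fun n =>
    ((hd n).differentiableAt (ball_mem_nhds c hr)).hasFDerivAt
  have hmaps : ∀ n, MapsTo (f n) (ball c r) (closedBall (f n c) (2 * M)) := fun n z hz => by
    rw [mem_closedBall, dist_eq_norm]
    linarith [norm_sub_le (f n z) (f n c), hM n z hz, hM n c hc]
  have hder : ∀ n, ‖fderiv ℂ (f n) c‖ ≤ 2 * M / r := fun n =>
    norm_fderiv_le_div_of_mapsTo_ball (hd n) (hmaps n) hr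
  have hrem : ∀ n, ∀ z ∈ ball c r,
      ‖f n z - f n c - fderiv ℂ (f n) c (z - c)‖ ≤ 4 * M * (dist z c / r) ^ 2 := by
    intro n z hz
    have h := dist_le_mul_div_pow_of_mapsTo_ball_of_isLittleO
      (f := fun z => f n z - fderiv ℂ (f n) c (z - c)) (c := c) (R₁ := r) (R₂ := 4 * M) (n := 1)
      ((hd n).sub (by fun_prop)) ?_ ?_ hz
    · rw [dist_eq_norm] at h
      simpa [sub_right_comm] using h
    · intro w hw
      have h1 : ‖fderiv ℂ (f n) c (w - c)‖ ≤ 2 * M := by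
        refine ((fderiv ℂ (f n) c).le_of_opNorm_le (hder n) _).trans ?_
        have h2 : ‖w - c‖ ≤ r := by rw [← dist_eq_norm]; exact (mem_ball.1 hw).le
        have h3 : 0 ≤ 2 * M / r := (norm_nonneg _).trans (hder n)
        calc 2 * M / r * ‖w - c‖ ≤ 2 * M / r * r := by gcongr
          _ = 2 * M := by field_simp
      have h4 := hmaps n hw
      rw [mem_closedBall, dist_eq_norm] at h4 ⊢
      simp only [sub_self, map_zero, sub_zero]
      rw [sub_right_comm]
      linarith [norm_sub_le (f n w - f n c) (fderiv ℂ (f n) c (w - c))]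
    · have h1 := (hfd n).isLittleO
      simpa [sub_right_comm] using! h1.norm_right
  obtain ⟨A, -, φ, hφ, hA⟩ := tendsto_subseq_of_bounded
    (isBounded_closedBall (x := (0 : E →L[ℂ] ℂ)) (r := 2 * M / r))
    (x := fun n => fderiv ℂ (f n) c) (fun n => by simpa using hder n)
  have hbd : ∀ z ∈ ball c r, ‖g z - g c - A (z - c)‖ ≤ 4 * M / r ^ 2 * ‖z - c‖ ^ 2 := by
    intro z hz
    have h1 : Tendsto (fun n => f (φ n) z - f (φ n) c - fderiv ℂ (f (φ n)) c (z - c)) atTop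
        (nhds (g z - g c - A (z - c))) :=
      (((hlim z hz).comp hφ.tendsto_atTop).sub ((hlim c hc).comp hφ.tendsto_atTop)).sub
        (((ContinuousLinearMap.apply ℂ ℂ (z - c)).continuous.tendsto A).comp hA)
    refine le_of_tendsto' h1.norm fun n => (hrem (φ n) z hz).trans (le_of_eq ?_)
    rw [dist_eq_norm]; field_simp
  refine (HasFDerivAt.of_isLittleO ?_ : HasFDerivAt g A c).differentiableAt
  have hO : (fun z => g z - g c - A (z - c)) =O[nhds c] fun z => ‖z - c‖ ^ 2 := by
    refine Asymptotics.IsBigO.of_bound (4 * M / r ^ 2) ?_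
    filter_upwards [ball_mem_nhds c hr] with z hz
    simpa using hbd z hz
  refine hO.trans_isLittleO ?_
  have h2 := (Asymptotics.isLittleO_norm_pow_id (E' := E) one_lt_two).comp_tendsto
    (k := fun z : E => z - c) (l' := nhds c) (by
      have : Tendsto (fun z : E => z - c) (nhds c) (nhds (c - c)) :=
        (continuous_id.sub continuous_const).tendsto c
      simpa using this)
  exact h2

/-- If each function in a chain is, up to the factor `-2si`, the derivative of its predecessor and
all of them blow up at most like `s ^ (-q)` at the origin, then the first one is Lipschitz, with a
constant depending only on the bounds. -/
theorem exists_lipschitz_bound_of_deriv_chain {r : ℝ} (hr : 0 < r) (q : ℕ) (B : ℕ → ℝ) :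
    ∃ M : ℝ, 0 ≤ M ∧ ∀ H : ℕ → ℝ → ℂ,
      (∀ j, ∀ s ∈ Set.Ioc 0 r, HasDerivAt (H j) (-(2 * s * I) * H (j + 1) s) s) →
      (∀ j, ∀ s ∈ Set.Ioc 0 r, s ^ q * ‖H j s‖ ≤ B j) →
      ∀ s ∈ Set.Ioc 0 r, ∀ t ∈ Set.Ioc 0 r, ‖H 0 s - H 0 t‖ ≤ M * |s - t| := by
  have hn : ∀ s : ℝ, 0 < s → ∀ w : ℂ, ‖-(2 * s * I) * w‖ = 2 * s * ‖w‖ := fun s hs w => by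
    simp [abs_of_pos hs]
  induction q generalizing B with
  | zero =>
    refine ⟨2 * r * |B 1|, by positivity, fun H hH hB s hs t ht => ?_⟩
    have := (convex_Ioc 0 r).norm_image_sub_le_of_norm_hasDerivWithin_le (f := H 0)
      (C := 2 * r * |B 1|) (fun u hu => (hH 0 u hu).hasDerivWithinAt) (fun u hu => ?_) ht hs
    · simpa using this
    · rw [hn u hu.1]
      have h1 := hB 1 u hu
      rw [pow_zero, one_mul] at h1
      gcongr
      · exact hu.2
      · exact h1.trans (le_abs_self _)
  | succ q ih =>
    obtain ⟨M, hM0, hM⟩ := ih fun j => B j / r + 2 * B (j + 1) * r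
    refine ⟨M, hM0, fun H hH hB => hM H hH fun j s hs => ?_⟩
    have hrm : r ∈ Set.Ioc 0 r := ⟨hr, le_rfl⟩
    have hBn : 0 ≤ B (j + 1) :=
      (mul_nonneg (pow_nonneg hr.le _) (norm_nonneg _)).trans (hB (j + 1) r hrm)
    have hs0 := hs.1
    have hsub : ∀ u ∈ Set.Icc s r, u ∈ Set.Ioc 0 r := fun u hu => ⟨hs0.trans_le hu.1, hu.2⟩
    have h1 := (convex_Icc s r).norm_image_sub_le_of_norm_hasDerivWithin_le (f := H j)
      (C := 2 * B (j + 1) / s ^ q)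
      (fun u hu => (hH j u (hsub u hu)).hasDerivWithinAt) (fun u hu => ?_)
      (Set.right_mem_Icc.2 hs.2) (Set.left_mem_Icc.2 hs.2)
    · have h2 : ‖s - r‖ ≤ r := by
        rw [Real.norm_eq_abs, abs_le]; constructor <;> linarith [hs.2]
      have h3 : ‖H j s‖ ≤ ‖H j r‖ + 2 * B (j + 1) / s ^ q * r := by
        have h4 : 2 * B (j + 1) / s ^ q * ‖s - r‖ ≤ 2 * B (j + 1) / s ^ q * r := by gcongr
        have h5 := norm_sub_norm_le (H j s) (H j r)
        linarith
      have h6 : s ^ q * ‖H j r‖ ≤ B j / r := by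
        rw [le_div_iff₀ hr]
        refine le_trans ?_ (hB j r hrm)
        rw [pow_succ, mul_right_comm]
        gcongr
        exact hs.2
      calc s ^ q * ‖H j s‖ ≤ s ^ q * (‖H j r‖ + 2 * B (j + 1) / s ^ q * r) := by gcongr
        _ = s ^ q * ‖H j r‖ + 2 * B (j + 1) * r := by field_simp
        _ ≤ _ := by linarith
    · have hu0 := (hsub u hu).1
      rw [hn u hu0, le_div_iff₀ (by positivity)]
      calc 2 * u * ‖H (j + 1) u‖ * s ^ q ≤ 2 * u * ‖H (j + 1) u‖ * u ^ q := by
            gcongr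
            exact hu.1
        _ = 2 * (u ^ (q + 1) * ‖H (j + 1) u‖) := by ring
        _ ≤ _ := by gcongr; exact hB (j + 1) u (hsub u hu)

open Set Topology in
/-- A function that is Lipschitz on `(0, r]` has a limit at `0` from the right, with a rate. -/
theorem exists_tendsto_nhdsGT_zero_of_lipschitz {h : ℝ → ℂ} {r M : ℝ} (hr : 0 < r) (hM : 0 ≤ M)
    (hh : ∀ s ∈ Ioc 0 r, ∀ t ∈ Ioc 0 r, ‖h s - h t‖ ≤ M * |s - t|) :
    ∃ ℓ : ℂ, Tendsto h (𝓝[>] 0) (𝓝 ℓ) ∧ ∀ s ∈ Ioc 0 r, ‖h s - ℓ‖ ≤ M * s := by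
  have hmem : Ioc 0 r ∈ 𝓝[>] (0 : ℝ) := Ioc_mem_nhdsGT hr
  have hlip : LipschitzOnWith M.toNNReal h (Ioc 0 r) :=
    LipschitzOnWith.of_dist_le_mul fun s hs t ht => by
      rw [dist_eq_norm, Real.dist_eq, Real.coe_toNNReal _ hM]; exact hh s hs t ht
  have hca : Cauchy (map h (𝓝[>] (0 : ℝ))) := by
    have h1 : Cauchy (𝓝[>] (0 : ℝ)) := cauchy_nhds.mono inf_le_left
    exact h1.map_of_le hlip.uniformContinuousOn (le_principal_iff.2 hmem)
  obtain ⟨ℓ, hℓ⟩ := CompleteSpace.complete hca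
  have hℓ' : Tendsto h (𝓝[>] 0) (𝓝 ℓ) := hℓ
  refine ⟨ℓ, hℓ', fun s hs => ?_⟩
  refine le_of_tendsto ((tendsto_const_nhds (x := h s)).sub hℓ').norm ?_
  filter_upwards [hmem, Ioc_mem_nhdsGT hs.1] with t ht ht'
  refine (hh s hs t ht).trans ?_
  gcongr
  rw [abs_of_nonneg (by linarith [ht'.2])]
  linarith [ht'.1]

/-- Polynomially weighted Schwartz functions are integrable. -/
theorem SchwartzMap.integrable_one_add_norm_pow_mul {E F : Type*} [NormedAddCommGroup E]
    [NormedSpace ℝ E] [NormedAddCommGroup F] [NormedSpace ℝ F] [MeasurableSpace E] [BorelSpace E]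
    [SecondCountableTopology E] (μ : Measure E) [μ.HasTemperateGrowth] (f : SchwartzMap E F)
    (m : ℕ) : Integrable (fun x => (1 + ‖x‖) ^ m * ‖f x‖) μ := by
  have h : ∀ k, Integrable (fun x => ‖x‖ ^ k * ‖f x‖) μ := fun k => f.integrable_pow_mul μ k
  simp_rw [add_comm (1 : ℝ), add_pow, one_pow, mul_one, Finset.sum_mul]
  refine integrable_finsetSum _ fun k _ => ?_
  simpa [mul_right_comm] using (h k).mul_const (m.choose k : ℝ)

section Slab

variable {E : Type*} [NormedAddCommGroup E] [NormedSpace ℝ E]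
  {v : E} {b A : ℝ} {N m : ℕ} {F : E → ℂ → ℂ}

/-- Functions on `E × {0 < im ζ < b}` that depend on `(x, ζ)` through `x + ζ v` only, are
holomorphic in `ζ`, and grow at most polynomially in `x` and in `(im ζ)⁻¹`. -/
structure IsSlowlyGrowingAlong (v : E) (b A : ℝ) (N m : ℕ) (F : E → ℂ → ℂ) : Prop where
  translate : ∀ x (s : ℝ) ζ, F (x + s • v) ζ = F x (ζ + s)
  continuous : ∀ t ∈ Set.Ioo 0 b, Continuous fun x => F x (t * I)
  differentiableOn : ∀ x, DifferentiableOn ℂ (F x) (im ⁻¹' Set.Ioo 0 b)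
  bound : ∀ x, ∀ t ∈ Set.Ioo 0 b, t ^ N * ‖F x (t * I)‖ ≤ A * (1 + ‖x‖) ^ m

namespace IsSlowlyGrowingAlong

theorem norm_le (hF : IsSlowlyGrowingAlong v b A N m F) (x : E) {t : ℝ} (ht : t ∈ Set.Ioo 0 b) :
    ‖F x (t * I)‖ ≤ A / t ^ N * (1 + ‖x‖) ^ m := by
  rw [div_mul_eq_mul_div, le_div_iff₀ (pow_pos ht.1 N), mul_comm]
  exact hF.bound x t ht

theorem nonneg (hF : IsSlowlyGrowingAlong v b A N m F) (hb : 0 < b) : 0 ≤ A := by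
  have h := hF.bound 0 (b / 2) ⟨by linarith, by linarith⟩
  simp only [norm_zero, add_zero, one_pow, mul_one] at h
  exact le_trans (by positivity) h

theorem norm_mul_le (hF : IsSlowlyGrowingAlong v b A N m F) (f : SchwartzMap E ℂ) (x : E) {t : ℝ}
    (ht : t ∈ Set.Ioo 0 b) :
    ‖F x (t * I) * f x‖ ≤ A / t ^ N * ((1 + ‖x‖) ^ m * ‖f x‖) := by
  rw [norm_mul, ← mul_assoc]
  gcongr
  exact hF.norm_le x ht

theorem hasDerivAt (hF : IsSlowlyGrowingAlong v b A N m F) (x : E) {ζ : ℂ}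
    (hζ : ζ.im ∈ Set.Ioo 0 b) : HasDerivAt (F x) (deriv (F x) ζ) ζ :=
  ((hF.differentiableOn x).differentiableAt
    ((isOpen_Ioo.preimage continuous_im).mem_nhds hζ)).hasDerivAt

theorem hasLineDerivAt (hF : IsSlowlyGrowingAlong v b A N m F) (x : E) {t : ℝ}
    (ht : t ∈ Set.Ioo 0 b) :
    HasLineDerivAt ℝ (fun x => F x (t * I)) (deriv (F x) (t * I)) x v := by
  have h1 := hF.hasDerivAt x (ζ := t * I) (by simpa using ht)
  have h2 : HasDerivAt (fun s : ℝ => (t * I + s : ℂ)) 1 0 := by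
    simpa using (Complex.ofRealCLM.hasDerivAt (x := (0 : ℝ))).const_add (t * I : ℂ)
  have h3 := HasDerivAt.comp (0 : ℝ) (h₂ := F x) (h := fun s : ℝ => (t * I + s : ℂ))
    (h₂' := deriv (F x) (t * I)) (by simpa using h1) h2
  rw [HasLineDerivAt]
  simpa [hF.translate, Function.comp_def] using h3

theorem norm_deriv_le (hF : IsSlowlyGrowingAlong v b A N m F) (hb : 0 < b) (x : E) {t δ : ℝ}
    (hδ : 0 < δ) (h1 : 2 * δ < t) (h2 : t + δ < b) :
    ‖deriv (F x) (t * I)‖ ≤ A / δ ^ N * (1 + δ * ‖v‖) ^ m / δ * (1 + ‖x‖) ^ m := by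
  have hA := hF.nonneg hb
  have him : ∀ z ∈ Metric.closedBall (t * I : ℂ) δ, |z.re| ≤ δ ∧ δ < z.im ∧ z.im < b := by
    intro z hz
    rw [mem_closedBall_iff_norm] at hz
    have hr := (abs_re_le_norm _).trans hz
    have hi := (abs_im_le_norm _).trans hz
    simp only [sub_re, sub_im, mul_re, mul_im, ofReal_re, ofReal_im, I_re, I_im, mul_zero,
      mul_one, sub_zero, add_zero] at hr hi
    rw [abs_le] at hi
    exact ⟨hr, by linarith, by linarith⟩
  have hsub : Metric.closedBall (t * I : ℂ) δ ⊆ im ⁻¹' Set.Ioo 0 b := fun z hz =>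
    ⟨hδ.trans (him z hz).2.1, (him z hz).2.2⟩
  refine (norm_deriv_le_of_forall_mem_sphere_norm_le
    (C := A / δ ^ N * ((1 + δ * ‖v‖) * (1 + ‖x‖)) ^ m) hδ
    (DifferentiableOn.diffContOnCl_ball (hF.differentiableOn x) hsub) fun z hz => ?_).trans
      (le_of_eq ?_)
  · have hz' := Metric.sphere_subset_closedBall hz
    obtain ⟨hr, hi, -⟩ := him z hz'
    have hz2 : F x z = F (x + z.re • v) (z.im * I) := by
      rw [hF.translate, add_comm, re_add_im]
    rw [hz2]
    refine (hF.norm_le _ (hsub hz')).trans ?_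
    have h3 : 1 + ‖x + z.re • v‖ ≤ (1 + δ * ‖v‖) * (1 + ‖x‖) := by
      have h4 : ‖z.re • v‖ ≤ δ * ‖v‖ := by
        rw [norm_smul, Real.norm_eq_abs]; gcongr
      have h5 : 0 ≤ δ * ‖v‖ * ‖x‖ := by positivity
      linarith [norm_add_le x (z.re • v)]
    gcongr
  · rw [mul_pow]; ring

variable [MeasurableSpace E] [BorelSpace E] [FiniteDimensional ℝ E] (μ : Measure E) [μ.IsAddHaarMeasure]

theorem integrable_mul (hF : IsSlowlyGrowingAlong v b A N m F) (f : SchwartzMap E ℂ) {t : ℝ}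
    (ht : t ∈ Set.Ioo 0 b) : Integrable (fun x => F x (t * I) * f x) μ := by
  have := FiniteDimensional.proper_real E
  refine ((f.integrable_one_add_norm_pow_mul μ m).const_mul (A / t ^ N)).mono'
    ((hF.continuous t ht).mul f.continuous).aestronglyMeasurable
    (ae_of_all _ fun x => hF.norm_mul_le f x ht)

theorem pow_mul_norm_integral_le (hF : IsSlowlyGrowingAlong v b A N m F) (f : SchwartzMap E ℂ)
    {t : ℝ} (ht : t ∈ Set.Ioo 0 b) :
    t ^ N * ‖∫ x, F x (t * I) * f x ∂μ‖ ≤ A * ∫ x, (1 + ‖x‖) ^ m * ‖f x‖ ∂μ := by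
  have := FiniteDimensional.proper_real E
  have h := norm_integral_le_of_norm_le
    ((f.integrable_one_add_norm_pow_mul μ m).const_mul (A / t ^ N))
    (ae_of_all _ fun x => hF.norm_mul_le f x ht)
  rwa [integral_const_mul, div_mul_eq_mul_div, le_div_iff₀ (pow_pos ht.1 N), mul_comm] at h

open LineDeriv in
/-- The pairing with a Schwartz function is differentiable in the height, and integration by parts
moves the derivative to the Schwartz function. -/
theorem hasDerivAt_integral (hF : IsSlowlyGrowingAlong v b A N m F) (f : SchwartzMap E ℂ)
    {t : ℝ} (ht : t ∈ Set.Ioo 0 b) :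
    HasDerivAt (fun t : ℝ => ∫ x, F x (t * I) * f x ∂μ)
      (-I * ∫ x, F x (t * I) * (∂_{v} f : SchwartzMap E ℂ) x ∂μ) t := by
  have := FiniteDimensional.proper_real E
  obtain ⟨ht0, htb⟩ := ht
  have hb : 0 < b := ht0.trans htb
  obtain ⟨δ, hδ, hδ1, hδ2⟩ : ∃ δ > 0, 4 * δ < t ∧ t + 4 * δ < b := by
    refine ⟨min t (b - t) / 5, by have := lt_min ht0 (sub_pos.2 htb); positivity, ?_, ?_⟩ <;>
      linarith [min_le_left t (b - t), min_le_right t (b - t), lt_min ht0 (sub_pos.2 htb)]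
  have hball : ∀ s ∈ Metric.ball t δ, t - δ < s ∧ s < t + δ := fun s hs => by
    rw [Metric.mem_ball, Real.dist_eq, abs_lt] at hs
    constructor <;> linarith
  have hball' : ∀ s ∈ Metric.ball t δ, s ∈ Set.Ioo 0 b := fun s hs => by
    obtain ⟨h1, h2⟩ := hball s hs
    constructor <;> linarith
  set D : ℝ := A / δ ^ N * (1 + δ * ‖v‖) ^ m / δ
  have hmeas : AEStronglyMeasurable (fun x => deriv (F x) (t * I)) μ := by
    have h : (fun x => deriv (F x) (t * I)) = fun x => lineDeriv ℝ (fun x => F x (t * I)) x v :=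
      funext fun x => (hF.hasLineDerivAt x ⟨ht0, htb⟩).lineDeriv.symm
    rw [h]
    exact (measurable_lineDeriv (hF.continuous t ⟨ht0, htb⟩)).aestronglyMeasurable
  have hbd : ∀ s ∈ Metric.ball t δ, ∀ x,
      ‖deriv (F x) (s * I) * f x‖ ≤ D * ((1 + ‖x‖) ^ m * ‖f x‖) := by
    intro s hs x
    obtain ⟨h1, h2⟩ := hball s hs
    rw [norm_mul, ← mul_assoc]
    gcongr
    exact hF.norm_deriv_le hb x hδ (by linarith) (by linarith)
  have hint := (f.integrable_one_add_norm_pow_mul μ m).const_mul D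
  have htball : t ∈ Metric.ball t δ := Metric.mem_ball_self hδ
  have hint' : Integrable (fun x => deriv (F x) (t * I) * f x) μ :=
    hint.mono' (hmeas.mul f.continuous.aestronglyMeasurable)
      (ae_of_all _ fun x => hbd t htball x)
  have hparts : ∫ x, F x (t * I) * (∂_{v} f : SchwartzMap E ℂ) x ∂μ =
      -∫ x, deriv (F x) (t * I) * f x ∂μ :=
    integral_bilinear_hasLineDerivAt_right_eq_neg_left_of_integrable
      (B := ContinuousLinearMap.mul ℝ ℂ) hint' (hF.integrable_mul μ _ ⟨ht0, htb⟩)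
      (hF.integrable_mul μ f ⟨ht0, htb⟩) (fun x _ => hF.hasLineDerivAt x ⟨ht0, htb⟩)
      (fun x _ => by
        rw [SchwartzMap.lineDerivOp_apply_eq_fderiv]
        exact f.differentiableAt.hasFDerivAt.hasLineDerivAt v)
  have hmain := (hasDerivAt_integral_of_dominated_loc_of_deriv_le (μ := μ)
    (F := fun (s : ℝ) x => F x (s * I) * f x)
    (F' := fun (s : ℝ) x => I * (deriv (F x) (s * I) * f x))
    (bound := fun x => D * ((1 + ‖x‖) ^ m * ‖f x‖))
    (Metric.ball_mem_nhds t hδ) ?_ (hF.integrable_mul μ f ⟨ht0, htb⟩)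
    (hint'.const_mul I).aestronglyMeasurable
    (ae_of_all _ fun x s hs => by simpa using hbd s hs x) hint
    (ae_of_all _ fun x s hs => ?_)).2
  · rw [integral_const_mul] at hmain
    rwa [hparts, neg_mul_neg]
  · filter_upwards [Metric.ball_mem_nhds t hδ] with s hs
    exact (hF.integrable_mul μ f (hball' s hs)).aestronglyMeasurable
  · have h1 := hF.hasDerivAt x (ζ := s * I) (by simpa using hball' s hs)
    have h2 : HasDerivAt (fun s : ℝ => (s * I : ℂ)) I s := by
      simpa using (Complex.ofRealCLM.hasDerivAt (x := s)).mul_const I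
    refine ((h1.comp s h2).mul_const (f x)).congr_deriv ?_
    ring

open LineDeriv Set Topology in
/-- Boundary values in the sense of distributions exist and depend continuously on the function
under pointwise convergence with uniform growth bounds. -/
theorem exists_tendsto_boundary_values (hb : 0 < b) {G : ℕ → E → ℂ → ℂ}
    (hG : ∀ n, IsSlowlyGrowingAlong v b A N m (G n)) (hF : IsSlowlyGrowingAlong v b A N m F)
    (hlim : ∀ x, ∀ t ∈ Ioo 0 b, Tendsto (fun n => G n x (t * I)) atTop (𝓝 (F x (t * I))))
    (f : SchwartzMap E ℂ) :
    ∃ (ℓ : ℕ → ℂ) (Lim : ℂ),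
      (∀ n, Tendsto (fun t : ℝ => ∫ x, G n x (t * I) * f x ∂μ) (𝓝[>] 0) (𝓝 (ℓ n))) ∧
      Tendsto (fun t : ℝ => ∫ x, F x (t * I) * f x ∂μ) (𝓝[>] 0) (𝓝 Lim) ∧
      Tendsto ℓ atTop (𝓝 Lim) := by
  have := FiniteDimensional.proper_real E
  let D : ℕ → SchwartzMap E ℂ := fun j => (fun φ : SchwartzMap E ℂ => (∂_{v} φ))^[j] f
  have hD : ∀ j, D (j + 1) = ∂_{v} (D j) := fun j => Function.iterate_succ_apply' _ j f
  set r : ℝ := √b / 2 with hr_def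
  have hr : 0 < r := by positivity
  have hrb : ∀ s ∈ Ioc 0 r, s ^ 2 ∈ Ioo 0 b := fun s hs => by
    refine ⟨pow_pos hs.1 2, ?_⟩
    have h1 : s ^ 2 ≤ r ^ 2 := pow_le_pow_left₀ hs.1.le hs.2 2
    have h2 : r ^ 2 = b / 4 := by rw [hr_def, div_pow, Real.sq_sqrt hb.le]; norm_num
    linarith
  obtain ⟨M, hM0, hM⟩ := exists_lipschitz_bound_of_deriv_chain hr (2 * N)
    fun j => A * ∫ x, (1 + ‖x‖) ^ m * ‖D j x‖ ∂μ
  have hlip : ∀ Φ : E → ℂ → ℂ, IsSlowlyGrowingAlong v b A N m Φ → ∃ ℓ : ℂ,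
      Tendsto (fun t : ℝ => ∫ x, Φ x (t * I) * f x ∂μ) (𝓝[>] 0) (𝓝 ℓ) ∧
      ∀ s ∈ Ioc 0 r, ‖∫ x, Φ x ((s ^ 2 : ℝ) * I) * f x ∂μ - ℓ‖ ≤ M * s := by
    intro Φ hΦ
    have hΦM := hM (fun j s => ∫ x, Φ x ((s ^ 2 : ℝ) * I) * D j x ∂μ) (fun j s hs => by
      have h1 := hΦ.hasDerivAt_integral μ (D j) (hrb s hs)
      have h2 : HasDerivAt (fun s : ℝ => s ^ 2) (2 * s) s := by simpa using hasDerivAt_pow 2 s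
      refine (HasDerivAt.scomp (h := fun s : ℝ => s ^ 2) s h1 h2).congr_deriv ?_
      rw [hD, real_smul]
      push_cast
      ring) fun j s hs => by
        rw [pow_mul]
        exact hΦ.pow_mul_norm_integral_le μ (D j) (hrb s hs)
    obtain ⟨ℓ, hℓ, hrate⟩ := exists_tendsto_nhdsGT_zero_of_lipschitz hr hM0 hΦM
    refine ⟨ℓ, ?_, hrate⟩
    have hsqrt : Tendsto Real.sqrt (𝓝[>] 0) (𝓝[>] 0) := by
      refine tendsto_nhdsWithin_of_tendsto_nhds_of_eventually_within _ ?_ ?_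
      · simpa using (Real.continuous_sqrt.tendsto 0).mono_left nhdsWithin_le_nhds
      · filter_upwards [self_mem_nhdsWithin] with t ht using Real.sqrt_pos.2 ht
    refine (hℓ.comp hsqrt).congr' ?_
    filter_upwards [self_mem_nhdsWithin] with t ht
    simp only [Function.comp_apply, Real.sq_sqrt (mem_Ioi.1 ht).le]
    rfl
  choose ℓ hℓ hℓr using fun n => hlip (G n) (hG n)
  obtain ⟨Lim, hLim, hLimr⟩ := hlip F hF
  refine ⟨ℓ, Lim, hℓ, hLim, ?_⟩
  have hconv : ∀ t ∈ Ioo 0 b, Tendsto (fun n => ∫ x, G n x (t * I) * f x ∂μ) atTop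
      (𝓝 (∫ x, F x (t * I) * f x ∂μ)) := fun t ht =>
    tendsto_integral_of_dominated_convergence (fun x => A / t ^ N * ((1 + ‖x‖) ^ m * ‖f x‖))
      (fun n => ((hG n).integrable_mul μ f ht).aestronglyMeasurable)
      ((f.integrable_one_add_norm_pow_mul μ m).const_mul _)
      (fun n => ae_of_all _ fun x => (hG n).norm_mul_le f x ht)
      (ae_of_all _ fun x => (hlim x t ht).mul_const _)
  rw [Metric.tendsto_atTop']
  intro e he
  set s := min r (e / (4 * (M + 1))) with hs_def
  have hs : s ∈ Ioc 0 r := ⟨by positivity, min_le_left _ _⟩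
  have hMs : M * s ≤ e / 4 := by
    have h1 : s ≤ e / (4 * (M + 1)) := min_le_right _ _
    calc M * s ≤ (M + 1) * (e / (4 * (M + 1))) := by
          have := hs.1
          gcongr
          linarith
      _ = e / 4 := by field_simp
  obtain ⟨n₀, hn₀⟩ := Metric.tendsto_atTop'.1 (hconv _ (hrb s hs)) (e / 4) (by positivity)
  refine ⟨n₀, fun n hn => ?_⟩
  have h1 := hn₀ n hn
  have h2 := hℓr n s hs
  have h3 := hLimr s hs
  rw [← dist_eq_norm] at h2 h3
  rw [dist_comm] at h2
  linarith [dist_triangle4 (ℓ n) (∫ x, G n x ((s ^ 2 : ℝ) * I) * f x ∂μ)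
    (∫ x, F x ((s ^ 2 : ℝ) * I) * f x ∂μ) Lim]

end IsSlowlyGrowingAlong

end Slab

section Tube

variable {d : ℕ} {V : Set (Fin d → ℝ)} {a C : ℝ} {L K : ℕ}

theorem isOpen_tube (hV : IsOpen V) :
    IsOpen {z : Fin d → ℂ | (fun k => (z k).im) ∈ V ∧ √(∑ k, (z k).im ^ 2) < a} := by
  have h : Continuous fun z : Fin d → ℂ => fun k => (z k).im :=
    continuous_pi fun k => continuous_im.comp (continuous_apply k)
  have h' : Continuous fun z : Fin d → ℂ => √(∑ k, (z k).im ^ 2) :=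
    Real.continuous_sqrt.comp (continuous_finsetSum _ fun k _ =>
      (continuous_im.comp (continuous_apply k)).pow 2)
  exact (hV.preimage h).inter (isOpen_lt h' continuous_const)

theorem sum_sq_pos_of_ne_zero {y : Fin d → ℝ} (hy : y ≠ 0) : 0 < ∑ k, y k ^ 2 := by
  obtain ⟨k, hk⟩ := Function.ne_iff.1 hy
  exact Finset.sum_pos' (fun k _ => sq_nonneg _) ⟨k, Finset.mem_univ k, sq_pos_of_ne_zero hk⟩

theorem one_add_sum_sq_le (x : Fin d → ℝ) :
    1 + ∑ k, x k ^ 2 ≤ (1 + d) * (1 + ‖x‖) ^ 2 := by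
  have h1 : ∑ k, x k ^ 2 ≤ d * ‖x‖ ^ 2 := by
    refine (Finset.sum_le_card_nsmul _ _ (‖x‖ ^ 2) fun k _ => ?_).trans (by simp)
    rw [← sq_abs]
    exact pow_le_pow_left₀ (abs_nonneg _) (norm_le_pi_norm x k) 2
  have h2 : (0 : ℝ) ≤ d := d.cast_nonneg
  nlinarith [norm_nonneg x, mul_nonneg h2 (norm_nonneg x)]

/-- Restriction of a slowly growing holomorphic function on a tube to the complex lines in a
direction of the cone. -/
theorem isSlowlyGrowingAlong_of_tube (hV0 : (0 : Fin d → ℝ) ∉ V)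
    (hVsmul : ∀ y ∈ V, ∀ t : ℝ, 0 < t → t • y ∈ V) (hC : 0 < C)
    {G : (Fin d → ℂ) → ℂ}
    (hG : DifferentiableOn ℂ G
      {z : Fin d → ℂ | (fun k => (z k).im) ∈ V ∧ √(∑ k, (z k).im ^ 2) < a})
    (hbound : ∀ z : Fin d → ℂ, (fun k => (z k).im) ∈ V → √(∑ k, (z k).im ^ 2) < a →
      ‖G z‖ ≤ C * (1 + ∑ k, (z k).re ^ 2) ^ L / (∑ k, (z k).im ^ 2) ^ K)
    {v : Fin d → ℝ} (hv : v ∈ V) :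
    IsSlowlyGrowingAlong v (a / √(∑ k, v k ^ 2))
      (C * (1 + d) ^ L / (∑ k, v k ^ 2) ^ K) (2 * K) (2 * L)
      fun x ζ => G fun k => (x k : ℂ) + ζ * v k := by
  have hS : 0 < ∑ k, v k ^ 2 := sum_sq_pos_of_ne_zero fun h => hV0 (h ▸ hv)
  have him : ∀ (x : Fin d → ℝ) (ζ : ℂ), (fun k => ((x k : ℂ) + ζ * v k).im) = ζ.im • v :=
    fun x ζ => by ext k; simp
  have hsum : ∀ (x : Fin d → ℝ) (ζ : ℂ),
      ∑ k, ((x k : ℂ) + ζ * v k).im ^ 2 = ζ.im ^ 2 * ∑ k, v k ^ 2 := fun x ζ => by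
    simp [Finset.mul_sum, mul_pow]
  have hmem : ∀ (x : Fin d → ℝ) (ζ : ℂ), ζ.im ∈ Set.Ioo 0 (a / √(∑ k, v k ^ 2)) →
      (fun k => ((x k : ℂ) + ζ * v k).im) ∈ V ∧
        √(∑ k, ((x k : ℂ) + ζ * v k).im ^ 2) < a := fun x ζ hζ => by
    rw [him, hsum, Real.sqrt_mul (sq_nonneg _), Real.sqrt_sq hζ.1.le]
    exact ⟨hVsmul v hv _ hζ.1, (lt_div_iff₀ (Real.sqrt_pos.2 hS)).1 hζ.2⟩
  refine ⟨fun x s ζ => ?_, fun t ht => ?_, fun x => ?_, fun x t ht => ?_⟩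
  · congr 1
    ext k
    simp only [Pi.add_apply, Pi.smul_apply, smul_eq_mul, ofReal_add, ofReal_mul]
    ring
  · refine hG.continuousOn.comp_continuous (by fun_prop) fun x => hmem x _ (by simpa using ht)
  · exact hG.comp (by fun_prop) fun ζ hζ => hmem x ζ hζ
  · have h1 : ((t : ℂ) * I).im = t := by simp
    obtain ⟨h2, h3⟩ := hmem x (t * I) (by rwa [h1])
    have h4 := hbound _ h2 h3
    rw [hsum, h1] at h4
    have h5 : ∀ k, ((x k : ℂ) + t * I * v k).re = x k := fun k => by simp
    simp only [h5] at h4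
    have ht0 := ht.1
    calc t ^ (2 * K) * ‖G fun k => (x k : ℂ) + t * I * v k‖
        ≤ t ^ (2 * K) * (C * (1 + ∑ k, x k ^ 2) ^ L / (t ^ 2 * ∑ k, v k ^ 2) ^ K) := by gcongr
      _ = C * (1 + ∑ k, x k ^ 2) ^ L / (∑ k, v k ^ 2) ^ K := by
          rw [mul_pow, ← pow_mul]; field_simp
      _ ≤ C * ((1 + d) * (1 + ‖x‖) ^ 2) ^ L / (∑ k, v k ^ 2) ^ K := by
          gcongr
          exact one_add_sum_sq_le x
      _ = _ := by rw [mul_pow, ← pow_mul]; ring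

end Tube

/-- **Vladimirov's theorem on tube domains: convergence of boundary values.**
If the functions `gseq n` are holomorphic on the tube `W = {x+iy : y ∈ V, ‖y‖ < a}` over an
open convex cone `V`, satisfy the uniform slow-growth bound
`|gseq n (x+iy)| ≤ C (1+‖x‖²)^L ‖y‖^{-2K}` and converge pointwise to `g`, then `g` is
holomorphic with the same bound, and for every `v ∈ V` and Schwartz `f` the boundary
pairings converge: `lim_n [lim_{ε→0+} ∫ gseq n (x+iεv) f dx] = lim_{ε→0+} ∫ g(x+iεv) f dx`. -/
theorem tube_domain_boundary_values_converge
    (d : ℕ) (hd : 1 ≤ d)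
    (V : Set (Fin d → ℝ))
    (hVopen : IsOpen V) (hVne : V.Nonempty) (hV0 : (0 : Fin d → ℝ) ∉ V)
    (hVcone : ∀ y ∈ V, ∀ y' ∈ V, ∀ l m : ℝ, 0 < l → 0 < m → l • y + m • y' ∈ V)
    (a : ℝ) (ha : 0 < a)
    (C : ℝ) (hC : 0 < C) (L K : ℕ)
    (gseq : ℕ → (Fin d → ℂ) → ℂ) (g : (Fin d → ℂ) → ℂ)
    (hgseq : ∀ n, DifferentiableOn ℂ (gseq n)
      {z : Fin d → ℂ | (fun k => (z k).im) ∈ V ∧ Real.sqrt (∑ k, (z k).im ^ 2) < a})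
    (hbound : ∀ n, ∀ z : Fin d → ℂ,
      (fun k => (z k).im) ∈ V → Real.sqrt (∑ k, (z k).im ^ 2) < a →
      ‖gseq n z‖ ≤ C * (1 + ∑ k, (z k).re ^ 2) ^ L / (∑ k, (z k).im ^ 2) ^ K)
    (hlim : ∀ z : Fin d → ℂ,
      (fun k => (z k).im) ∈ V → Real.sqrt (∑ k, (z k).im ^ 2) < a →
      Tendsto (fun n => gseq n z) atTop (nhds (g z))) :
    (DifferentiableOn ℂ g
      {z : Fin d → ℂ | (fun k => (z k).im) ∈ V ∧ Real.sqrt (∑ k, (z k).im ^ 2) < a}) ∧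
    (∀ z : Fin d → ℂ,
      (fun k => (z k).im) ∈ V → Real.sqrt (∑ k, (z k).im ^ 2) < a →
      ‖g z‖ ≤ C * (1 + ∑ k, (z k).re ^ 2) ^ L / (∑ k, (z k).im ^ 2) ^ K) ∧
    (∀ v ∈ V, ∀ f : SchwartzMap (Fin d → ℝ) ℂ,
      ∃ (ℓ : ℕ → ℂ) (Lim : ℂ),
        (∀ n, Tendsto
          (fun ε : ℝ => ∫ x : Fin d → ℝ,
            gseq n (fun k => (x k : ℂ) + (ε * v k : ℝ) * Complex.I) * f x)
          (nhdsWithin 0 (Set.Ioi 0)) (nhds (ℓ n))) ∧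
        Tendsto
          (fun ε : ℝ => ∫ x : Fin d → ℝ,
            g (fun k => (x k : ℂ) + (ε * v k : ℝ) * Complex.I) * f x)
          (nhdsWithin 0 (Set.Ioi 0)) (nhds Lim) ∧
        Tendsto ℓ atTop (nhds Lim)) := by
  have hVsmul : ∀ y ∈ V, ∀ t : ℝ, 0 < t → t • y ∈ V := fun y hy t ht => by
    have := hVcone y hy y hy (t / 2) (t / 2) (half_pos ht) (half_pos ht)
    rwa [← add_smul, add_halves] at this
  have hgb : ∀ z : Fin d → ℂ, (fun k => (z k).im) ∈ V → √(∑ k, (z k).im ^ 2) < a →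
      ‖g z‖ ≤ C * (1 + ∑ k, (z k).re ^ 2) ^ L / (∑ k, (z k).im ^ 2) ^ K := fun z hz hza =>
    le_of_tendsto' (hlim z hz hza).norm fun n => hbound n z hz hza
  have hgd : DifferentiableOn ℂ g
      {z : Fin d → ℂ | (fun k => (z k).im) ∈ V ∧ √(∑ k, (z k).im ^ 2) < a} := by
    intro c hc
    have hS : 0 < ∑ k, (c k).im ^ 2 := sum_sq_pos_of_ne_zero fun h => hV0 (h ▸ hc.1)
    have hcont : ContinuousAt (fun z : Fin d → ℂ =>
        C * (1 + ∑ k, (z k).re ^ 2) ^ L / (∑ k, (z k).im ^ 2) ^ K) c := by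
      refine ContinuousAt.div (Continuous.continuousAt ?_) (Continuous.continuousAt ?_)
        (pow_pos hS K).ne'
      · have : Continuous fun z : Fin d → ℂ => ∑ k, (z k).re ^ 2 :=
          continuous_finsetSum _ fun k _ => (continuous_re.comp (continuous_apply k)).pow 2
        fun_prop
      · have : Continuous fun z : Fin d → ℂ => ∑ k, (z k).im ^ 2 :=
          continuous_finsetSum _ fun k _ => (continuous_im.comp (continuous_apply k)).pow 2
        fun_prop
    obtain ⟨r, hr, hball⟩ := Metric.mem_nhds_iff.1
      (((isOpen_tube hVopen).eventually_mem hc).and (hcont.eventually_lt_const (lt_add_one _)))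
    exact (differentiableAt_of_tendsto_of_norm_le hr
      (fun n => (hgseq n).mono fun z hz => (hball hz).1)
      (fun n z hz => (hbound n z (hball hz).1.1 (hball hz).1.2).trans (hball hz).2.le)
      fun z hz => hlim z (hball hz).1.1 (hball hz).1.2).differentiableWithinAt
  refine ⟨hgd, hgb, fun v hv f => ?_⟩
  have hS : 0 < ∑ k, v k ^ 2 := sum_sq_pos_of_ne_zero fun h => hV0 (h ▸ hv)
  have hF := isSlowlyGrowingAlong_of_tube hV0 hVsmul hC hgd hgb hv
  have hG := fun n => isSlowlyGrowingAlong_of_tube hV0 hVsmul hC (hgseq n) (hbound n) hv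
  have hpt : ∀ (x : Fin d → ℝ) (ε : ℝ), (fun k => (x k : ℂ) + (ε * v k : ℝ) * I) =
      fun k => (x k : ℂ) + ε * I * v k := fun x ε => by
    ext k; push_cast; ring
  simp only [hpt]
  refine hF.exists_tendsto_boundary_values volume (div_pos ha (Real.sqrt_pos.2 hS)) hG
    (fun x t ht => hlim _ ?_ ?_) f
  · have : (fun k => ((x k : ℂ) + t * I * v k).im) = t • v := by ext k; simp
    rw [this]
    exact hVsmul v hv t ht.1
  · have : ∑ k, ((x k : ℂ) + t * I * v k).im ^ 2 = t ^ 2 * ∑ k, v k ^ 2 := by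
      simp [Finset.mul_sum, mul_pow]
    rw [this, Real.sqrt_mul (sq_nonneg _), Real.sqrt_sq ht.1.le]
    exact (lt_div_iff₀ (Real.sqrt_pos.2 hS)).1 ht.2
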